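/- arXiv:2207.11130 — 9 statements merged into one kernel-verified Lean document; each statement's English description precedes it below -/
import Mathlib

section
/- Let d be a positive integer, A ∈ Matrix (Fin d) (Fin d) ℝ be symmetric, b ∈ ℝ^d, c ∈ ℝ, and define the quadratic Hamiltonian H(z) = (1/2) zᵀ A z + bᵀ z + c, whose gradient is ∇H(z) = A z + b. Let S : ℝ^d → Matrix (Fin d) (Fin d) ℝ satisfy S(w)ᵀ = −S(w) for all w, and let Δt ∈ ℝ. If z⁰, z¹ ∈ ℝ^d satisfy the implicit midpoint relation z¹ − z⁰ = Δt · S(m) (A m + b) with m = (z⁰ + z¹)/2, then H(z¹) = H(z⁰). -/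
open Matrix

theorem Matrix.dotProduct_mulVec_self_eq_zero_of_transpose_eq_neg {n : Type*} [Fintype n]
    {S : Matrix n n ℝ} (hS : Sᵀ = -S) (v : n → ℝ) : v ⬝ᵥ S *ᵥ v = 0 := by
  have h : v ⬝ᵥ S *ᵥ v = -(v ⬝ᵥ S *ᵥ v) := by
    conv_lhs => rw [dotProduct_mulVec, ← mulVec_transpose, hS, neg_mulVec, neg_dotProduct,
      dotProduct_comm]
  linarith

theorem Matrix.IsSymm.dotProduct_mulVec_comm {n : Type*} [Fintype n]
    {A : Matrix n n ℝ} (hA : A.IsSymm) (v w : n → ℝ) : v ⬝ᵥ A *ᵥ w = w ⬝ᵥ A *ᵥ v := by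
  rw [dotProduct_mulVec, ← mulVec_transpose, hA.eq, dotProduct_comm]

/-- The implicit midpoint rule applied to a skew-gradient system with a quadratic
Hamiltonian `H(z) = (1/2) zᵀAz + bᵀz + c` exactly preserves the Hamiltonian. -/
theorem implicit_midpoint_preserves_quadratic_hamiltonian
    (d : ℕ) (hd : 0 < d)
    (A : Matrix (Fin d) (Fin d) ℝ) (hA : A.IsSymm) (b : Fin d → ℝ) (c : ℝ)
    (H : (Fin d → ℝ) → ℝ)
    (hH : ∀ z, H z = (1/2) * (z ⬝ᵥ A.mulVec z) + b ⬝ᵥ z + c)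
    (S : (Fin d → ℝ) → Matrix (Fin d) (Fin d) ℝ)
    (hS : ∀ w, (S w)ᵀ = -(S w))
    (Δt : ℝ) (z0 z1 m : Fin d → ℝ) (hm : m = (z0 + z1) / 2)
    (hstep : z1 - z0 = Δt • (S m).mulVec (A.mulVec m + b)) :
    H z1 = H z0 := by
  have hm' : m = (1 / 2 : ℝ) • (z0 + z1) := by
    rw [hm]
    ext i
    simp
    ring
  have horth : (z1 - z0) ⬝ᵥ (A *ᵥ m + b) = 0 := by
    rw [hstep, smul_dotProduct, dotProduct_comm,
      dotProduct_mulVec_self_eq_zero_of_transpose_eq_neg (hS m), smul_zero]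
  rw [hm'] at horth
  simp only [mulVec_smul, mulVec_add, dotProduct_add, sub_dotProduct, dotProduct_smul,
    smul_eq_mul] at horth
  rw [hH, hH, dotProduct_comm b, dotProduct_comm b]
  linarith [hA.dotProduct_mulVec_comm z0 z1]
end

section
/- Fix an integer N ≥ 1 and reals h > 0 and γ. If p, q : ℝ → (ℤ/Nℤ → ℝ) are differentiable and satisfy the Ablowitz–Ladik equation (ALE) for all t ∈ ℝ and all n ∈ ℤ/Nℤ, then the discrete Hamiltonian is conserved along the solution: H(p(t), q(t)) = H(p(0), q(0)) for all t ∈ ℝ. -/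
/-- Summation by parts on a cyclic group: the variation of `∑ uₙ uₙ₋₁` in direction `v`. -/
theorem sum_variation_mul_shift {G R : Type*} [AddGroupWithOne G] [Fintype G] [CommRing R]
    (u v : G → R) :
    ∑ n, (v n * u (n - 1) + u n * v (n - 1)) = ∑ n, v n * (u (n + 1) + u (n - 1)) := by
  have hshift : ∑ n, u n * v (n - 1) = ∑ n, u (n + 1) * v n := by
    rw [← Equiv.sum_comp (Equiv.addRight (1 : G)) fun n => u n * v (n - 1)]
    simp
  rw [Finset.sum_add_distrib, hshift, ← Finset.sum_add_distrib]
  exact Finset.sum_congr rfl fun n _ => by ring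


/-- Solutions of the Ablowitz–Ladik equation conserve the discrete Hamiltonian
`H(p,q) = (1/h²) Σₙ (pₙ pₙ₋₁ + qₙ qₙ₋₁)` (cyclic indices). -/
theorem ablowitz_ladik_conserves_hamiltonian
    (N : ℕ) [NeZero N] (h γ : ℝ) (hh : 0 < h)
    (p q : ℝ → ZMod N → ℝ)
    (hp : Differentiable ℝ p) (hq : Differentiable ℝ q)
    (hpode : ∀ (t : ℝ) (n : ZMod N), deriv (fun s => p s n) t =
      -(1/h^2) * (1 + γ * h^2 * ((p t n)^2 + (q t n)^2)) * (q t (n+1) + q t (n-1)))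
    (hqode : ∀ (t : ℝ) (n : ZMod N), deriv (fun s => q s n) t =
      (1/h^2) * (1 + γ * h^2 * ((p t n)^2 + (q t n)^2)) * (p t (n+1) + p t (n-1))) :
    ∀ t : ℝ,
      (1/h^2) * ∑ n : ZMod N, (p t n * p t (n-1) + q t n * q t (n-1)) =
      (1/h^2) * ∑ n : ZMod N, (p 0 n * p 0 (n-1) + q 0 n * q 0 (n-1)) := by
  have hdp (t : ℝ) (n : ZMod N) := (differentiableAt_pi.1 (hp t) n).hasDerivAt
  have hdq (t : ℝ) (n : ZMod N) := (differentiableAt_pi.1 (hq t) n).hasDerivAt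
  have hderiv (t : ℝ) :
      HasDerivAt (fun s => ∑ n : ZMod N, (p s n * p s (n-1) + q s n * q s (n-1))) 0 t := by
    refine (HasDerivAt.fun_sum fun n _ =>
      ((hdp t n).fun_mul (hdp t (n-1))).fun_add ((hdq t n).fun_mul (hdq t (n-1)))).congr_deriv ?_
    rw [Finset.sum_add_distrib,
      sum_variation_mul_shift (p t) (fun n => deriv (fun s => p s n) t),
      sum_variation_mul_shift (q t) (fun n => deriv (fun s => q s n) t),
      ← Finset.sum_add_distrib]
    refine Finset.sum_eq_zero fun n _ => ?_
    rw [hpode, hqode]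
    ring
  intro t
  congr 1
  exact is_const_of_deriv_eq_zero (fun s => (hderiv s).differentiableAt)
    (fun s => (hderiv s).deriv) t 0
end

section
/- Fix an integer N ≥ 1 and reals h > 0 and γ. If p, q : ℝ → (ℤ/Nℤ → ℝ) are differentiable and satisfy the Ablowitz–Ladik equation (ALE) for all t ∈ ℝ and all n ∈ ℤ/Nℤ, then the discrete momentum is conserved along the solution: I(p(t), q(t)) = I(p(0), q(0)) for all t ∈ ℝ. -/
/-- A sum over `ZMod N` of forward differences vanishes. -/
theorem sum_zmod_forward_difference (N : ℕ) [NeZero N] (V : ZMod N → ℝ) :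
    ∑ n : ZMod N, (V (n + 1) - V n) = 0 := by
  rw [Finset.sum_sub_distrib, sub_eq_zero]
  exact Equiv.sum_comp (Equiv.addRight (1 : ZMod N)) V

/-- Solutions of the Ablowitz–Ladik equation conserve the discrete momentum
`I(p,q) = Σₙ (qₙ(pₙ₊₁ − pₙ₋₁) − pₙ(qₙ₊₁ − qₙ₋₁))/(2h)` (cyclic indices). -/
theorem ablowitz_ladik_conserves_momentum
    (N : ℕ) [NeZero N] (h γ : ℝ) (hh : 0 < h)
    (p q : ℝ → ZMod N → ℝ)
    (hp : Differentiable ℝ p) (hq : Differentiable ℝ q)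
    (hpode : ∀ (t : ℝ) (n : ZMod N), deriv (fun s => p s n) t =
      -(1/h^2) * (1 + γ * h^2 * ((p t n)^2 + (q t n)^2)) * (q t (n+1) + q t (n-1)))
    (hqode : ∀ (t : ℝ) (n : ZMod N), deriv (fun s => q s n) t =
      (1/h^2) * (1 + γ * h^2 * ((p t n)^2 + (q t n)^2)) * (p t (n+1) + p t (n-1))) :
    ∀ t : ℝ,
      ∑ n : ZMod N, (q t n * (p t (n+1) - p t (n-1)) - p t n * (q t (n+1) - q t (n-1))) / (2*h) =
      ∑ n : ZMod N, (q 0 n * (p 0 (n+1) - p 0 (n-1)) - p 0 n * (q 0 (n+1) - q 0 (n-1))) / (2*h) := by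
  have hp' (t : ℝ) (n : ZMod N) :
      HasDerivAt (fun s => p s n) (deriv (fun s => p s n) t) t :=
    (differentiableAt_pi.1 (hp t) n).hasDerivAt
  have hq' (t : ℝ) (n : ZMod N) :
      HasDerivAt (fun s => q s n) (deriv (fun s => q s n) t) t :=
    (differentiableAt_pi.1 (hq t) n).hasDerivAt
  have momentum_hasDerivAt (t : ℝ) : HasDerivAt (fun s => ∑ n : ZMod N,
      (q s n * (p s (n+1) - p s (n-1)) - p s n * (q s (n+1) - q s (n-1))) / (2*h)) 0 t := by
    have hsum := HasDerivAt.fun_sum (u := Finset.univ) fun (n : ZMod N) _ =>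
      (((hq' t n).fun_mul ((hp' t (n+1)).fun_sub (hp' t (n-1)))).fun_sub
        ((hp' t n).fun_mul ((hq' t (n+1)).fun_sub (hq' t (n-1))))).div_const (2*h)
    refine hsum.congr_deriv ?_
    -- The summand is the forward difference of the momentum flux.
    rw [← sum_zmod_forward_difference N fun n =>
      (q t (n-1) * deriv (fun s => p s n) t + deriv (fun s => p s (n-1)) t * q t n
        - deriv (fun s => q s (n-1)) t * p t n - p t (n-1) * deriv (fun s => q s n) t
        + 2 / h^2 * ((p t n)^2 + (q t n)^2 + ((p t (n-1))^2 + (q t (n-1))^2)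
          + γ * h^2 * ((p t n)^2 + (q t n)^2) * ((p t (n-1))^2 + (q t (n-1))^2))) / (2*h)]
    refine Finset.sum_congr rfl fun n _ => ?_
    simp only [add_sub_cancel_right]
    rw [← sub_div]
    congr 1
    linear_combination 2 * (p t (n+1) - p t (n-1)) * hqode t n
      - 2 * (q t (n+1) - q t (n-1)) * hpode t n
  intro t
  exact is_const_of_deriv_eq_zero (fun s => (momentum_hasDerivAt s).differentiableAt)
    (fun s => (momentum_hasDerivAt s).deriv) t 0
end

section
/- Fix an integer N ≥ 1 and reals h > 0, γ, and μ. If p, q : ℝ → (ℤ/Nℤ → ℝ) are differentiable and satisfy the damped Ablowitz–Ladik equation for all t ∈ ℝ and all n ∈ ℤ/Nℤ, then the discrete Hamiltonian dissipates at the exact exponential rate: H(p(t), q(t)) = e^{−2μt} · H(p(0), q(0)) for all t ∈ ℝ. -/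
theorem ZMod.sum_mul_shift {N : ℕ} [NeZero N] (a b : ZMod N → ℝ) :
    ∑ n, a n * b (n - 1) = ∑ n, a (n + 1) * b n := by
  rw [← Equiv.sum_comp (Equiv.addRight (1 : ZMod N)) (fun n => a n * b (n - 1))]
  simp

/-- A solution of the scalar linear equation `f' = c f` is an exponential. -/
theorem eq_exp_mul_of_hasDerivAt {f : ℝ → ℝ} {c : ℝ}
    (hf : ∀ t, HasDerivAt f (c * f t) t) (t : ℝ) : f t = Real.exp (c * t) * f 0 := by
  have hd : ∀ s, HasDerivAt (fun s => Real.exp (-(c * s)) * f s) 0 s := fun s => by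
    have he : HasDerivAt (fun s => Real.exp (-(c * s))) (Real.exp (-(c * s)) * -(c * 1)) s :=
      (((hasDerivAt_id' s).const_mul c).fun_neg).exp
    exact (he.fun_mul (hf s)).congr_deriv (by ring)
  have hconst := is_const_of_deriv_eq_zero (fun s => (hd s).differentiableAt)
    (fun s => (hd s).deriv) t 0
  simp only [mul_zero, neg_zero, Real.exp_zero, one_mul] at hconst
  rw [← hconst, ← mul_assoc, ← Real.exp_add]
  simp

/-- Solutions of the damped Ablowitz–Ladik equation dissipate the discrete
Hamiltonian at the exact exponential rate: `H(p(t),q(t)) = e^{−2μt} H(p(0),q(0))`. -/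
theorem damped_ablowitz_ladik_hamiltonian_dissipation
    (N : ℕ) [NeZero N] (h γ μ : ℝ) (hh : 0 < h)
    (p q : ℝ → ZMod N → ℝ)
    (hp : Differentiable ℝ p) (hq : Differentiable ℝ q)
    (hpode : ∀ (t : ℝ) (n : ZMod N), deriv (fun s => p s n) t =
      -(1/h^2) * (1 + γ * h^2 * ((p t n)^2 + (q t n)^2)) * (q t (n+1) + q t (n-1)) - μ * p t n)
    (hqode : ∀ (t : ℝ) (n : ZMod N), deriv (fun s => q s n) t =
      (1/h^2) * (1 + γ * h^2 * ((p t n)^2 + (q t n)^2)) * (p t (n+1) + p t (n-1)) - μ * q t n) :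
    ∀ t : ℝ,
      (1/h^2) * ∑ n : ZMod N, (p t n * p t (n-1) + q t n * q t (n-1)) =
      Real.exp (-2*μ*t) * ((1/h^2) * ∑ n : ZMod N, (p 0 n * p 0 (n-1) + q 0 n * q 0 (n-1))) := by
  intro t
  have hp' := fun s n => ((differentiableAt_pi.1 (hp s)) n).hasDerivAt
  have hq' := fun s n => ((differentiableAt_pi.1 (hq s)) n).hasDerivAt
  have key : ∀ s, HasDerivAt
      (fun s => ∑ n : ZMod N, (p s n * p s (n - 1) + q s n * q s (n - 1)))
      (-2 * μ * ∑ n : ZMod N, (p s n * p s (n - 1) + q s n * q s (n - 1))) s := by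
    intro s
    have hsum := HasDerivAt.fun_sum (u := Finset.univ) fun (n : ZMod N) _ =>
      ((hp' s n).mul (hp' s (n - 1))).add ((hq' s n).mul (hq' s (n - 1)))
    refine hsum.congr_deriv ?_
    set dp : ZMod N → ℝ := fun n => deriv (fun r => p r n) s with hdp
    set dq : ZMod N → ℝ := fun n => deriv (fun r => q r n) s with hdq
    have shift : ∑ n, (dp n * p s (n - 1) + p s n * dp (n - 1)
          + (dq n * q s (n - 1) + q s n * dq (n - 1)))
        = ∑ n, (dp n * (p s (n + 1) + p s (n - 1)) + dq n * (q s (n + 1) + q s (n - 1))) := by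
      simp only [mul_add, Finset.sum_add_distrib, ZMod.sum_mul_shift (p s) dp,
        ZMod.sum_mul_shift (q s) dq]
      simp only [mul_comm (p s _) (dp _), mul_comm (q s _) (dq _)]
      ring
    have cancel : ∀ n, dp n * (p s (n + 1) + p s (n - 1)) + dq n * (q s (n + 1) + q s (n - 1))
        = -μ * (p s (n + 1) * p s n + p s n * p s (n - 1)
          + (q s (n + 1) * q s n + q s n * q s (n - 1))) := by
      intro n
      simp only [hdp, hdq, hpode, hqode]
      ring
    refine shift.trans ?_
    simp only [cancel, ← Finset.mul_sum, Finset.sum_add_distrib, ← ZMod.sum_mul_shift]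
    ring
  rw [eq_exp_mul_of_hasDerivAt key t]
  ring
end

section
/- Fix an integer N ≥ 1 and reals h > 0, γ, and μ. If p, q : ℝ → (ℤ/Nℤ → ℝ) are differentiable and satisfy the damped Ablowitz–Ladik equation for all t ∈ ℝ and all n ∈ ℤ/Nℤ, then the discrete momentum dissipates at the exact exponential rate: I(p(t), q(t)) = e^{−2μt} · I(p(0), q(0)) for all t ∈ ℝ. -/
/-- Summation by parts: the centered momentum sum equals the forward one. -/
theorem sum_centered_momentum_eq {N : ℕ} [NeZero N] (h : ℝ) (p q : ZMod N → ℝ) :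
    ∑ n, (q n * (p (n+1) - p (n-1)) - p n * (q (n+1) - q (n-1))) / (2*h) =
      (∑ n, (q n * p (n+1) - p n * q (n+1))) / h := by
  have hshift := Equiv.sum_comp (Equiv.subRight (1 : ZMod N))
    (fun n => q n * p (n+1) - p n * q (n+1))
  simp only [Equiv.subRight_apply, sub_add_cancel] at hshift
  rw [← Finset.sum_div]
  have hsum : ∑ n, (q n * (p (n+1) - p (n-1)) - p n * (q (n+1) - q (n-1))) =
      2 * ∑ n, (q n * p (n+1) - p n * q (n+1)) := by
    rw [two_mul]
    nth_rewrite 2 [← hshift]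
    rw [← Finset.sum_add_distrib]
    exact Finset.sum_congr rfl fun n _ => by ring
  rw [hsum, mul_div_mul_left _ _ two_ne_zero]

/-- Solutions of the damped Ablowitz–Ladik equation dissipate the discrete
momentum at the exact exponential rate: `I(p(t),q(t)) = e^{−2μt} I(p(0),q(0))`. -/
theorem damped_ablowitz_ladik_momentum_dissipation
    (N : ℕ) [NeZero N] (h γ μ : ℝ) (hh : 0 < h)
    (p q : ℝ → ZMod N → ℝ)
    (hp : Differentiable ℝ p) (hq : Differentiable ℝ q)
    (hpode : ∀ (t : ℝ) (n : ZMod N), deriv (fun s => p s n) t =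
      -(1/h^2) * (1 + γ * h^2 * ((p t n)^2 + (q t n)^2)) * (q t (n+1) + q t (n-1)) - μ * p t n)
    (hqode : ∀ (t : ℝ) (n : ZMod N), deriv (fun s => q s n) t =
      (1/h^2) * (1 + γ * h^2 * ((p t n)^2 + (q t n)^2)) * (p t (n+1) + p t (n-1)) - μ * q t n) :
    ∀ t : ℝ,
      ∑ n : ZMod N, (q t n * (p t (n+1) - p t (n-1)) - p t n * (q t (n+1) - q t (n-1))) / (2*h) =
      Real.exp (-2*μ*t) *
        ∑ n : ZMod N, (q 0 n * (p 0 (n+1) - p 0 (n-1)) - p 0 n * (q 0 (n+1) - q 0 (n-1))) / (2*h) := by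
  have hp' (t : ℝ) (n : ZMod N) := (differentiableAt_pi.1 (hp t) n).hasDerivAt
  have hq' (t : ℝ) (n : ZMod N) := (differentiableAt_pi.1 (hq t) n).hasDerivAt
  simp only [hpode] at hp'
  simp only [hqode] at hq'
  have hW : ∀ t, HasDerivAt (fun s => ∑ n, (q s n * p s (n+1) - p s n * q s (n+1)))
      ((-2*μ) * ∑ n, (q t n * p t (n+1) - p t n * q t (n+1))) t := fun t => by
    have hd := HasDerivAt.fun_sum (u := Finset.univ) fun (n : ZMod N) _ =>
      ((hq' t n).fun_mul (hp' t (n+1))).fun_sub ((hp' t n).fun_mul (hq' t (n+1)))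
    refine hd.congr_deriv ?_
    -- the conservative part of the flux is the discrete divergence of `F`
    let F : ZMod N → ℝ := fun n =>
      (1/h^2) * (1 + γ * h^2 * ((p t n)^2 + (q t n)^2)) *
        (p t (n-1) * p t (n+1) + q t (n-1) * q t (n+1)) - (1/h^2) * ((p t n)^2 + (q t n)^2)
    have hF : ∑ n, (F n - F (n+1)) = 0 := by
      rw [Finset.sum_sub_distrib, sub_eq_zero]
      exact (Equiv.sum_comp (Equiv.addRight (1 : ZMod N)) F).symm
    rw [← add_zero (-2 * μ * _), ← hF, Finset.mul_sum, ← Finset.sum_add_distrib]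
    refine Finset.sum_congr rfl fun n _ => ?_
    simp only [F, add_sub_cancel_right]
    ring
  intro t
  rw [sum_centered_momentum_eq, sum_centered_momentum_eq, eq_exp_mul_of_hasDerivAt hW t,
    mul_div_assoc]
end

section
/- Fix an integer N ≥ 1 and reals h > 0, γ, μ, and Δt. Let (p⁰, q⁰) and (p¹, q¹) be functions ℤ/Nℤ → ℝ related by one step of the exponential midpoint rule for the damped Ablowitz–Ladik equation: setting u = e^{μΔt/2}(p¹, q¹), v = e^{−μΔt/2}(p⁰, q⁰), and (m^p, m^q) = (u + v)/2, suppose u^p_n − v^p_n = −(Δt/h²)(1 + γh²((m^p_n)² + (m^q_n)²))(m^q_{n+1} + m^q_{n−1}) and u^q_n − v^q_n = (Δt/h²)(1 + γh²((m^p_n)² + (m^q_n)²))(m^p_{n+1} + m^p_{n−1}) for all n ∈ ℤ/Nℤ. Then the discrete Hamiltonian dissipates with the exact rate: H(p¹, q¹) = e^{−2μΔt} · H(p⁰, q⁰). -/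
/-- Discrete gradient identity for the nearest-neighbour quadratic form on `ZMod N`: its increment
is the increment of the argument paired with the gradient at the midpoint. -/
lemma sum_mul_shift_sub_sum_mul_shift {N : ℕ} [NeZero N] (u v : ZMod N → ℝ) :
    ∑ n, u n * u (n-1) - ∑ n, v n * v (n-1) =
      ∑ n, (u n - v n) * ((u (n+1) + v (n+1)) / 2 + (u (n-1) + v (n-1)) / 2) := by
  have shift : ∑ n, (u n - v n) * ((u (n+1) + v (n+1)) / 2) =
      ∑ n, (u (n-1) - v (n-1)) * ((u n + v n) / 2) := by
    refine Fintype.sum_equiv (Equiv.addRight (1 : ZMod N)) _ _ fun n => ?_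
    simp
  simp_rw [mul_add]
  rw [Finset.sum_add_distrib, shift, ← Finset.sum_sub_distrib, ← Finset.sum_add_distrib]
  exact Finset.sum_congr rfl fun n _ => by ring

/-- One step of the exponential midpoint rule for the damped Ablowitz–Ladik
equation dissipates the discrete Hamiltonian with the exact rate:
`H(p¹,q¹) = e^{−2μΔt} H(p⁰,q⁰)`. -/
theorem exponential_midpoint_hamiltonian_dissipation
    (N : ℕ) [NeZero N] (h γ μ Δt : ℝ) (hh : 0 < h)
    (p0 q0 p1 q1 mp mq : ZMod N → ℝ)
    (hmp : ∀ n, mp n = (Real.exp (μ*Δt/2) * p1 n + Real.exp (-(μ*Δt/2)) * p0 n) / 2)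
    (hmq : ∀ n, mq n = (Real.exp (μ*Δt/2) * q1 n + Real.exp (-(μ*Δt/2)) * q0 n) / 2)
    (hstepp : ∀ n, Real.exp (μ*Δt/2) * p1 n - Real.exp (-(μ*Δt/2)) * p0 n =
      -(Δt/h^2) * (1 + γ*h^2*((mp n)^2 + (mq n)^2)) * (mq (n+1) + mq (n-1)))
    (hstepq : ∀ n, Real.exp (μ*Δt/2) * q1 n - Real.exp (-(μ*Δt/2)) * q0 n =
      (Δt/h^2) * (1 + γ*h^2*((mp n)^2 + (mq n)^2)) * (mp (n+1) + mp (n-1))) :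
    (1/h^2) * ∑ n : ZMod N, (p1 n * p1 (n-1) + q1 n * q1 (n-1)) =
      Real.exp (-2*μ*Δt) * ((1/h^2) * ∑ n : ZMod N, (p0 n * p0 (n-1) + q0 n * q0 (n-1))) := by
  set E := Real.exp (μ*Δt/2) with hE
  set F := Real.exp (-(μ*Δt/2)) with hF
  have hEF : E * F = 1 := by rw [hE, hF, ← Real.exp_add]; simp
  have hF4 : Real.exp (-2*μ*Δt) = F^4 := by
    rw [hF, ← Real.exp_nat_mul]
    congr 1
    push_cast
    ring
  have hp := sum_mul_shift_sub_sum_mul_shift (fun n => E * p1 n) (fun n => F * p0 n)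
  have hq := sum_mul_shift_sub_sum_mul_shift (fun n => E * q1 n) (fun n => F * q0 n)
  simp only [← hmp, ← hmq, hstepp, hstepq] at hp hq
  have cancel :
      ∑ n, -(Δt/h^2) * (1 + γ*h^2*((mp n)^2 + (mq n)^2)) * (mq (n+1) + mq (n-1)) *
          (mp (n+1) + mp (n-1)) +
        ∑ n, (Δt/h^2) * (1 + γ*h^2*((mp n)^2 + (mq n)^2)) * (mp (n+1) + mp (n-1)) *
          (mq (n+1) + mq (n-1)) = 0 := by
    rw [← Finset.sum_add_distrib]
    exact Finset.sum_eq_zero fun n _ => by ring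
  have scale (c : ℝ) (f : ZMod N → ℝ) :
      ∑ n, c * f n * (c * f (n-1)) = c^2 * ∑ n, f n * f (n-1) := by
    rw [Finset.mul_sum]
    exact Finset.sum_congr rfl fun n _ => by ring
  rw [scale, scale] at hp hq
  rw [hF4, Finset.sum_add_distrib, Finset.sum_add_distrib]
  set P1 := ∑ n, p1 n * p1 (n-1)
  set Q1 := ∑ n, q1 n * q1 (n-1)
  set P0 := ∑ n, p0 n * p0 (n-1)
  set Q0 := ∑ n, q0 n * q0 (n-1)
  have balance : E^2 * (P1 + Q1) = F^2 * (P0 + Q0) := by linear_combination hp + hq + cancel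
  have rate : P1 + Q1 = F^4 * (P0 + Q0) := by
    linear_combination F^2 * balance - (E * F + 1) * (P1 + Q1) * hEF
  rw [rate]
  ring
end

section
/- Fix an integer N ≥ 1 and reals h > 0, γ, μ, and Δt. Let (p⁰, q⁰) and (p¹, q¹) be functions ℤ/Nℤ → ℝ related by one step of the exponential midpoint rule for the damped Ablowitz–Ladik equation: setting u = e^{μΔt/2}(p¹, q¹), v = e^{−μΔt/2}(p⁰, q⁰), and (m^p, m^q) = (u + v)/2, suppose u^p_n − v^p_n = −(Δt/h²)(1 + γh²((m^p_n)² + (m^q_n)²))(m^q_{n+1} + m^q_{n−1}) and u^q_n − v^q_n = (Δt/h²)(1 + γh²((m^p_n)² + (m^q_n)²))(m^p_{n+1} + m^p_{n−1}) for all n ∈ ℤ/Nℤ. Then the discrete momentum dissipates with the exact rate: I(p¹, q¹) = e^{−2μΔt} · I(p⁰, q⁰). -/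
/-- Summation by parts: the centered difference on a cyclic grid is skew-symmetric. -/
theorem sum_mul_centered_diff_skew {N : ℕ} [NeZero N] (a b : ZMod N → ℝ) :
    ∑ n, a n * (b (n+1) - b (n-1)) = -∑ n, b n * (a (n+1) - a (n-1)) := by
  have shift (f g : ZMod N → ℝ) : ∑ n, f n * g (n+1) = ∑ n, g n * f (n-1) :=
    Fintype.sum_equiv (Equiv.addRight 1) _ _ fun n => by simp [mul_comm]
  simp only [mul_sub, Finset.sum_sub_distrib, shift]
  ring

/-- The implicit midpoint rule for the undamped Ablowitz–Ladik equation, with `c = Δt/h²` and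
`κ = γh²`, conserves the (unnormalized) discrete momentum. -/
theorem ablowitzLadik_midpoint_momentum_conservation {N : ℕ} [NeZero N] (c κ : ℝ)
    (up uq vp vq mp mq : ZMod N → ℝ)
    (hmp : ∀ n, mp n = (up n + vp n) / 2) (hmq : ∀ n, mq n = (uq n + vq n) / 2)
    (hp : ∀ n, up n - vp n = -c * (1 + κ * (mp n ^ 2 + mq n ^ 2)) * (mq (n+1) + mq (n-1)))
    (hq : ∀ n, uq n - vq n = c * (1 + κ * (mp n ^ 2 + mq n ^ 2)) * (mp (n+1) + mp (n-1))) :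
    ∑ n, (uq n * (up (n+1) - up (n-1)) - up n * (uq (n+1) - uq (n-1))) =
      ∑ n, (vq n * (vp (n+1) - vp (n-1)) - vp n * (vq (n+1) - vq (n-1))) := by
  let dp : ZMod N → ℝ := fun n => up n - vp n
  let dq : ZMod N → ℝ := fun n => uq n - vq n
  let R : ZMod N → ℝ := fun n => mp n ^ 2 + mq n ^ 2
  have polar (n : ZMod N) :
      (uq n * (up (n+1) - up (n-1)) - up n * (uq (n+1) - uq (n-1))) -
        (vq n * (vp (n+1) - vp (n-1)) - vp n * (vq (n+1) - vq (n-1))) =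
      (dq n * (mp (n+1) - mp (n-1)) - dp n * (mq (n+1) - mq (n-1))) +
        (mq n * (dp (n+1) - dp (n-1)) - mp n * (dq (n+1) - dq (n-1))) := by
    simp only [dp, dq, hmp, hmq]
    ring
  have flux (n : ZMod N) :
      dq n * (mp (n+1) - mp (n-1)) - dp n * (mq (n+1) - mq (n-1)) =
        c * (R (n+1) - R (n-1)) + c * κ * (R n * (R (n+1) - R (n-1))) := by
    simp only [dp, dq, R, hp, hq]
    ring
  have sum_flux :
      ∑ n, (dq n * (mp (n+1) - mp (n-1)) - dp n * (mq (n+1) - mq (n-1))) = 0 := by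
    have h1 := sum_mul_centered_diff_skew (fun _ => (1 : ℝ)) R
    have hR := sum_mul_centered_diff_skew R R
    simp only [one_mul, sub_self, mul_zero, Finset.sum_const_zero, neg_zero] at h1
    simp only [flux, Finset.sum_add_distrib, ← Finset.mul_sum]
    rw [h1, self_eq_neg.mp hR]
    ring
  rw [← sub_eq_zero, ← Finset.sum_sub_distrib]
  simp only [polar]
  rw [Finset.sum_add_distrib, sum_flux, zero_add, Finset.sum_sub_distrib,
    sum_mul_centered_diff_skew mq dp, sum_mul_centered_diff_skew mp dq]
  rw [Finset.sum_sub_distrib] at sum_flux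
  linarith

/-- One step of the exponential midpoint rule for the damped Ablowitz–Ladik
equation dissipates the discrete momentum with the exact rate:
`I(p¹,q¹) = e^{−2μΔt} I(p⁰,q⁰)`. -/
theorem exponential_midpoint_momentum_dissipation
    (N : ℕ) [NeZero N] (h γ μ Δt : ℝ) (hh : 0 < h)
    (p0 q0 p1 q1 mp mq : ZMod N → ℝ)
    (hmp : ∀ n, mp n = (Real.exp (μ*Δt/2) * p1 n + Real.exp (-(μ*Δt/2)) * p0 n) / 2)
    (hmq : ∀ n, mq n = (Real.exp (μ*Δt/2) * q1 n + Real.exp (-(μ*Δt/2)) * q0 n) / 2)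
    (hstepp : ∀ n, Real.exp (μ*Δt/2) * p1 n - Real.exp (-(μ*Δt/2)) * p0 n =
      -(Δt/h^2) * (1 + γ*h^2*((mp n)^2 + (mq n)^2)) * (mq (n+1) + mq (n-1)))
    (hstepq : ∀ n, Real.exp (μ*Δt/2) * q1 n - Real.exp (-(μ*Δt/2)) * q0 n =
      (Δt/h^2) * (1 + γ*h^2*((mp n)^2 + (mq n)^2)) * (mp (n+1) + mp (n-1))) :
    ∑ n : ZMod N, (q1 n * (p1 (n+1) - p1 (n-1)) - p1 n * (q1 (n+1) - q1 (n-1))) / (2*h) =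
      Real.exp (-2*μ*Δt) *
        ∑ n : ZMod N, (q0 n * (p0 (n+1) - p0 (n-1)) - p0 n * (q0 (n+1) - q0 (n-1))) / (2*h) := by
  have key := ablowitzLadik_midpoint_momentum_conservation (Δt/h^2) (γ*h^2)
    (fun n => Real.exp (μ*Δt/2) * p1 n) (fun n => Real.exp (μ*Δt/2) * q1 n)
    (fun n => Real.exp (-(μ*Δt/2)) * p0 n) (fun n => Real.exp (-(μ*Δt/2)) * q0 n)
    mp mq hmp hmq hstepp hstepq
  have scale (e : ℝ) (p q : ZMod N → ℝ) :
      ∑ n, (e * q n * (e * p (n+1) - e * p (n-1)) - e * p n * (e * q (n+1) - e * q (n-1))) =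
        e ^ 2 * ∑ n, (q n * (p (n+1) - p (n-1)) - p n * (q (n+1) - q (n-1))) := by
    rw [Finset.mul_sum]
    exact Finset.sum_congr rfl fun n _ => by ring
  rw [scale, scale] at key
  have inv : Real.exp (-(μ*Δt/2)) ^ 2 * Real.exp (μ*Δt/2) ^ 2 = 1 := by
    rw [← mul_pow, ← Real.exp_add]
    simp
  have rate : Real.exp (-2*μ*Δt) = Real.exp (-(μ*Δt/2)) ^ 2 * Real.exp (-(μ*Δt/2)) ^ 2 := by
    simp only [← Real.exp_nat_mul, ← Real.exp_add]
    congr 1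
    push_cast
    ring
  rw [← Finset.sum_div, ← Finset.sum_div, ← mul_div_assoc, rate, mul_assoc, ← key, ← mul_assoc,
    inv, one_mul]
end

section
/- Fix an integer N ≥ 1 and reals h > 0, γ, and Δt. Let (p⁰, q⁰) and (p¹, q¹) be functions ℤ/Nℤ → ℝ related by one implicit midpoint step of the Ablowitz–Ladik equation: with m^p = (p⁰ + p¹)/2 and m^q = (q⁰ + q¹)/2, suppose p¹_n − p⁰_n = −(Δt/h²)(1 + γh²((m^p_n)² + (m^q_n)²))(m^q_{n+1} + m^q_{n−1}) and q¹_n − q⁰_n = (Δt/h²)(1 + γh²((m^p_n)² + (m^q_n)²))(m^p_{n+1} + m^p_{n−1}) for all n ∈ ℤ/Nℤ. Then the discrete momentum is exactly preserved: I(p¹, q¹) = I(p⁰, q⁰). -/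
/-- The central difference on a finite cyclic group is skew-adjoint. -/
theorem sum_mul_centralDiff_eq_neg {N : ℕ} [NeZero N] (a b : ZMod N → ℝ) :
    ∑ n, a n * (b (n + 1) - b (n - 1)) = -∑ n, b n * (a (n + 1) - a (n - 1)) := by
  have key (f g : ZMod N → ℝ) : ∑ n, f n * g (n + 1) = ∑ n, g n * f (n - 1) := by
    rw [← Equiv.sum_comp (Equiv.addRight (1 : ZMod N)) (fun n => g n * f (n - 1))]
    exact Finset.sum_congr rfl fun n _ => by simp [mul_comm]
  simp only [mul_sub, Finset.sum_sub_distrib]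
  rw [key a b, key b a]
  ring

/-- One implicit midpoint step of the Ablowitz–Ladik equation exactly preserves
the discrete momentum `I(p,q) = Σₙ (qₙ(pₙ₊₁ − pₙ₋₁) − pₙ(qₙ₊₁ − qₙ₋₁))/(2h)`. -/
theorem implicit_midpoint_preserves_momentum
    (N : ℕ) [NeZero N] (h γ Δt : ℝ) (hh : 0 < h)
    (p0 q0 p1 q1 mp mq : ZMod N → ℝ)
    (hmp : ∀ n, mp n = (p0 n + p1 n) / 2)
    (hmq : ∀ n, mq n = (q0 n + q1 n) / 2)
    (hstepp : ∀ n, p1 n - p0 n =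
      -(Δt/h^2) * (1 + γ*h^2*((mp n)^2 + (mq n)^2)) * (mq (n+1) + mq (n-1)))
    (hstepq : ∀ n, q1 n - q0 n =
      (Δt/h^2) * (1 + γ*h^2*((mp n)^2 + (mq n)^2)) * (mp (n+1) + mp (n-1))) :
    ∑ n : ZMod N, (q1 n * (p1 (n+1) - p1 (n-1)) - p1 n * (q1 (n+1) - q1 (n-1))) / (2*h) =
    ∑ n : ZMod N, (q0 n * (p0 (n+1) - p0 (n-1)) - p0 n * (q0 (n+1) - q0 (n-1))) / (2*h) := by
  rw [← Finset.sum_div, ← Finset.sum_div]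
  congr 1
  rw [← sub_eq_zero, ← Finset.sum_sub_distrib]
  have skew_p := sum_mul_centralDiff_eq_neg mq (fun n => p1 n - p0 n)
  have skew_q := sum_mul_centralDiff_eq_neg mp (fun n => q1 n - q0 n)
  have hr : ∑ n, (1 + γ*h^2*((mp n)^2 + (mq n)^2)) *
      (((mp (n+1))^2 + (mq (n+1))^2) - ((mp (n-1))^2 + (mq (n-1))^2)) = 0 := by
    have skew_one := sum_mul_centralDiff_eq_neg (fun _ => (1 : ℝ)) (fun n => (mp n)^2 + (mq n)^2)
    have skew_self := sum_mul_centralDiff_eq_neg (fun n => (mp n)^2 + (mq n)^2)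
      (fun n => (mp n)^2 + (mq n)^2)
    simp only [sub_self, mul_zero, Finset.sum_const_zero, neg_zero, one_mul] at skew_one
    simp only [add_mul, one_mul, mul_assoc, Finset.sum_add_distrib, ← Finset.mul_sum] at skew_self ⊢
    rw [skew_one]
    linear_combination (γ * h^2 / 2) * skew_self
  have hdiff : ∑ n, ((p1 n - p0 n) * (mq (n+1) - mq (n-1)) -
      (q1 n - q0 n) * (mp (n+1) - mp (n-1))) = 0 := by
    rw [← mul_zero (-(Δt/h^2)), ← hr, Finset.mul_sum]
    refine Finset.sum_congr rfl fun n _ => ?_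
    rw [hstepp, hstepq]
    ring
  rw [Finset.sum_sub_distrib] at hdiff
  have expand : ∀ n, (q1 n * (p1 (n+1) - p1 (n-1)) - p1 n * (q1 (n+1) - q1 (n-1))) -
      (q0 n * (p0 (n+1) - p0 (n-1)) - p0 n * (q0 (n+1) - q0 (n-1))) =
      ((q1 n - q0 n) * (mp (n+1) - mp (n-1)) +
        mq n * ((p1 (n+1) - p0 (n+1)) - (p1 (n-1) - p0 (n-1)))) -
      ((p1 n - p0 n) * (mq (n+1) - mq (n-1)) +
        mp n * ((q1 (n+1) - q0 (n+1)) - (q1 (n-1) - q0 (n-1)))) := by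
    intro n
    simp only [hmp, hmq]
    ring
  rw [Finset.sum_congr rfl fun n _ => expand n, Finset.sum_sub_distrib,
    Finset.sum_add_distrib, Finset.sum_add_distrib]
  linear_combination skew_p - skew_q - 2 * hdiff
end

section
/- Let d, r be positive integers, let A ∈ Matrix (Fin d) (Fin d) ℝ be symmetric, b ∈ ℝ^d, c ∈ ℝ, and define the quadratic Hamiltonian H(z) = (1/2) zᵀ A z + bᵀ z + c with gradient ∇H(z) = A z + b. Let S : ℝ^d → Matrix (Fin d) (Fin d) ℝ satisfy S(w)ᵀ = −S(w) for all w, let V ∈ Matrix (Fin d) (Fin r) ℝ be arbitrary, and let Δt ∈ ℝ. If z_r⁰, z_r¹ ∈ ℝ^r satisfy the implicit midpoint step of the reduced skew-gradient system, z_r¹ − z_r⁰ = Δt · Vᵀ S(V m_r) V · Vᵀ (A V m_r + b) with m_r = (z_r⁰ + z_r¹)/2, then the reduced Hamiltonian is exactly preserved: H(V z_r¹) = H(V z_r⁰). -/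
open Matrix

/-- The quadratic form of a skew-symmetric real matrix vanishes. -/
theorem dotProduct_mulVec_self_of_transpose_eq_neg {n : Type*} [Fintype n]
    {M : Matrix n n ℝ} (hM : Mᵀ = -M) (v : n → ℝ) : v ⬝ᵥ M *ᵥ v = 0 := by
  have h : v ⬝ᵥ M *ᵥ v = -(v ⬝ᵥ M *ᵥ v) := by
    conv_lhs => rw [dotProduct_mulVec, ← mulVec_transpose, hM, neg_mulVec, neg_dotProduct,
      dotProduct_comm]
  linarith

/-- The bilinear form of a symmetric matrix is symmetric. -/
theorem dotProduct_mulVec_comm_of_isSymm {n : Type*} [Fintype n]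
    {A : Matrix n n ℝ} (hA : A.IsSymm) (x y : n → ℝ) : x ⬝ᵥ A *ᵥ y = y ⬝ᵥ A *ᵥ x := by
  rw [dotProduct_mulVec, ← mulVec_transpose, hA.eq, dotProduct_comm]

/-- The increment of a quadratic function is the gradient at the midpoint, paired with the
displacement. -/
theorem quadratic_sub_eq_midpoint_gradient_dotProduct {n : Type*} [Fintype n]
    {A : Matrix n n ℝ} (hA : A.IsSymm) (b x y : n → ℝ) :
    ((1 / 2) * (y ⬝ᵥ A *ᵥ y) + b ⬝ᵥ y) - ((1 / 2) * (x ⬝ᵥ A *ᵥ x) + b ⬝ᵥ x) =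
      (y - x) ⬝ᵥ (A *ᵥ ((1 / 2 : ℝ) • (x + y)) + b) := by
  have h := dotProduct_mulVec_comm_of_isSymm hA x y
  simp only [mulVec_smul, mulVec_add, dotProduct_add, dotProduct_smul, sub_dotProduct,
    smul_eq_mul, dotProduct_comm b]
  linarith

/-- The implicit midpoint step of the POD reduced skew-gradient system with a
quadratic Hamiltonian exactly preserves the reduced Hamiltonian
`H(V z_r¹) = H(V z_r⁰)`. -/
theorem reduced_implicit_midpoint_preserves_hamiltonian
    (d r : ℕ) (hd : 0 < d) (hr : 0 < r)
    (A : Matrix (Fin d) (Fin d) ℝ) (hA : A.IsSymm) (b : Fin d → ℝ) (c : ℝ)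
    (H : (Fin d → ℝ) → ℝ)
    (hH : ∀ z, H z = (1/2) * (z ⬝ᵥ A.mulVec z) + b ⬝ᵥ z + c)
    (S : (Fin d → ℝ) → Matrix (Fin d) (Fin d) ℝ)
    (hS : ∀ w, (S w)ᵀ = -(S w))
    (V : Matrix (Fin d) (Fin r) ℝ) (Δt : ℝ)
    (zr0 zr1 mr : Fin r → ℝ) (hmr : mr = (zr0 + zr1) / 2)
    (hstep : zr1 - zr0 = Δt •
      (Vᵀ * S (V.mulVec mr) * V).mulVec (Vᵀ.mulVec (A.mulVec (V.mulVec mr) + b))) :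
    H (V.mulVec zr1) = H (V.mulVec zr0) := by
  have hm : V *ᵥ mr = (1 / 2 : ℝ) • (V *ᵥ zr0 + V *ᵥ zr1) := by
    rw [← mulVec_add, ← mulVec_smul, hmr]
    congr 1
    ext i
    simp only [Pi.div_apply, Pi.add_apply, Pi.smul_apply, Pi.ofNat_apply, smul_eq_mul]
    ring
  have hskew : (Vᵀ * S (V *ᵥ mr) * V)ᵀ = -(Vᵀ * S (V *ᵥ mr) * V) := by
    simp [transpose_mul, hS, Matrix.mul_assoc]
  have hdiff := quadratic_sub_eq_midpoint_gradient_dotProduct hA b (V *ᵥ zr0) (V *ᵥ zr1)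
  have hzero : (V *ᵥ zr1 - V *ᵥ zr0) ⬝ᵥ (A *ᵥ (V *ᵥ mr) + b) = 0 := by
    rw [← mulVec_sub, dotProduct_comm, dotProduct_mulVec, ← mulVec_transpose, hstep,
      dotProduct_smul, dotProduct_mulVec_self_of_transpose_eq_neg hskew, smul_zero]
  rw [← hm, hzero] at hdiff
  rw [hH, hH]
  linarith
end
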